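/- arXiv:1409.7518 — 6 statements merged into one kernel-verified Lean document; each statement's English description precedes it below -/
import Mathlib

section
/- Let G be a finite group with trivial 2-core (i.e., the only normal subgroup of G that is a 2-group is the trivial subgroup), and suppose G is isomorphic to the group of units of some ring. Then there exist r ≥ 0 and positive integers n₁,…,n_r and k₁,…,k_r such that G is isomorphic to the direct product GL_{n₁}(F_{2^{k₁}}) × ⋯ × GL_{n_r}(F_{2^{k_r}}) of general linear groups over finite fields of characteristic 2. -/
theorem aux_field (D : Type) [DivisionRing D] [Finite D] (h2 : (2 : D) = 0) :
    ∃ k : ℕ, 1 ≤ k ∧ Nonempty (D ≃+* GaloisField 2 k) := by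
  let : Field D := littleWedderburn D
  have : CharP D 2 := CharTwo.of_one_ne_zero_of_two_eq_zero one_ne_zero h2
  let : Algebra (ZMod 2) D := ZMod.algebra D 2
  refine ⟨Module.finrank (ZMod 2) D, Module.finrank_pos, ⟨?_⟩⟩
  exact (GaloisField.algEquivGaloisField 2 _
    (FiniteField.pow_finrank_eq_natCard 2 D).symm).toRingEquiv

theorem aux_semisimple (S : Type) [Ring S] [Finite S] (h2 : (2 : S) = 0) [IsSemisimpleRing S] :
    ∃ (r : ℕ) (n k : Fin r → ℕ), (∀ i, 1 ≤ n i) ∧ (∀ i, 1 ≤ k i) ∧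
      Nonempty (Sˣ ≃* ∀ i : Fin r,
        Matrix.GeneralLinearGroup (Fin (n i)) (GaloisField 2 (k i))) := by
  obtain ⟨r, D, d, _, hd, ⟨e⟩⟩ := IsSemisimpleRing.exists_ringEquiv_pi_matrix_divisionRing S
  have hfin : ∀ i, Finite (D i) := by
    intro i
    refine Finite.of_surjective (fun s : S => e s i 0 0) fun x => ?_
    refine ⟨e.symm (Function.update 0 i (Matrix.of fun _ _ => x)), ?_⟩
    simp
  have h2' : ∀ i, (2 : D i) = 0 := by
    intro i
    have h : e 2 = 0 := by rw [h2, map_zero]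
    have h' := congrFun (congrFun (congrFun h i) 0) 0
    rw [map_ofNat] at h'
    simpa [Matrix.ofNat_apply] using h'
  choose k hk hek using fun i => aux_field (D i) (h2' i)
  refine ⟨r, d, k, fun i => Nat.one_le_iff_ne_zero.mpr (hd i).ne, hk, ⟨?_⟩⟩
  refine (Units.mapEquiv e.toMulEquiv).trans (MulEquiv.piUnits.trans ?_)
  exact MulEquiv.piCongrRight fun i =>
    Units.mapEquiv ((hek i).some.mapMatrix (m := Fin (d i))).toMulEquiv

theorem aux_jacobson (S : Type) [Ring S] [Finite S] [CharP S 2]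
    (h2core : ∀ N : Subgroup Sˣ, N.Normal → IsPGroup 2 N → N = ⊥) :
    IsSemisimpleRing S := by
  rw [IsArtinianRing.isSemisimpleRing_iff_jacobson]
  obtain ⟨n, hn⟩ := IsSemiprimaryRing.isNilpotent (R := S)
  have hnil : ∀ x ∈ Ring.jacobson S, x ^ 2 ^ n = 0 := by
    intro x hx
    have h1 : x ^ n = 0 := by
      have := Ideal.pow_mem_pow hx n
      rw [hn] at this
      simpa using this
    exact pow_eq_zero_of_le Nat.lt_two_pow_self.le h1
  let f := Units.map (Ideal.Quotient.mk (Ring.jacobson S) : S →* S ⧸ Ring.jacobson S)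
  have hN := h2core f.ker inferInstance ?_
  · rw [eq_bot_iff]
    intro x hx
    have hu : IsUnit (1 + x) := IsNilpotent.isUnit_one_add ⟨_, hnil x hx⟩
    obtain ⟨u, hu⟩ := hu
    have hm : u ∈ f.ker := by
      rw [MonoidHom.mem_ker]
      ext
      simp [f, hu, Ideal.Quotient.eq_zero_iff_mem.mpr hx]
    rw [hN, Subgroup.mem_bot] at hm
    subst hm
    simpa using hu
  · rintro ⟨u, hu⟩
    refine ⟨n, ?_⟩
    ext
    rw [MonoidHom.mem_ker] at hu
    have h1 : (u : S) - 1 ∈ Ring.jacobson S := by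
      rw [← Ideal.Quotient.eq_zero_iff_mem, map_sub, map_one, sub_eq_zero]
      exact congrArg Units.val hu
    have h3 := add_pow_char_pow_of_commute (p := 2) (n := n) (Commute.one_left ((u : S) - 1))
    rw [hnil _ h1] at h3
    simpa using h3

theorem aux_neg_one (R : Type) [Ring R]
    (h2core : ∀ N : Subgroup Rˣ, N.Normal → IsPGroup 2 N → N = ⊥) : (2 : R) = 0 := by
  have h := h2core (Subgroup.zpowers (-1)) ?_ ?_
  · rw [Subgroup.zpowers_eq_bot] at h
    have h' : (-1 : R) = 1 := by simpa using congrArg Units.val h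
    rw [← one_add_one_eq_two]
    nth_rewrite 1 [← h']
    simp
  · refine ⟨fun x hx g => ?_⟩
    obtain ⟨m, rfl⟩ := Subgroup.mem_zpowers_iff.mp hx
    have hc : Commute g ((-1 : Rˣ) ^ m) := (Commute.neg_one_right g).zpow_right m
    rw [hc.eq, mul_inv_cancel_right]
    exact hx
  · rintro ⟨x, hx⟩
    obtain ⟨m, rfl⟩ := Subgroup.mem_zpowers_iff.mp hx
    refine ⟨1, ?_⟩
    ext
    simp only [SubmonoidClass.mk_pow, pow_one]
    rw [← zpow_natCast, zpow_comm]
    simp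

theorem aux_core {G H : Type} [Group G] [Group H] (e : G ≃* H)
    (h2core : ∀ N : Subgroup G, N.Normal → IsPGroup 2 N → N = ⊥) :
    ∀ N : Subgroup H, N.Normal → IsPGroup 2 N → N = ⊥ := by
  intro N hN hp
  have h := h2core (N.comap e.toMonoidHom) inferInstance
    (hp.comap_of_injective _ e.injective)
  rw [eq_bot_iff]
  intro x hx
  have hm : e.symm x ∈ N.comap e.toMonoidHom := by simpa using hx
  rw [h, Subgroup.mem_bot] at hm
  simpa using hm

theorem aux_sub (R : Type) [Ring R] [Finite Rˣ] [CharP R 2] :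
    ∃ (S : Type) (_ : Ring S) (_ : Finite S) (_ : CharP S 2), Nonempty (Rˣ ≃* Sˣ) := by
  let : Algebra (ZMod 2) R := ZMod.algebra R 2
  have : Nontrivial R := CharP.nontrivial_of_char_ne_one (v := 2) (by norm_num)
  let U : Submonoid R := IsUnit.submonoid R
  let S := Algebra.adjoin (ZMod 2) (U : Set R)
  have hU : (U : Set R).Finite := by
    have : (U : Set R) = Set.range (Units.val : Rˣ → R) := rfl
    rw [this]
    exact Set.finite_range _
  have hfin : Finite S := by
    have h : Subalgebra.toSubmodule S = Submodule.span (ZMod 2) (U : Set R) := by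
      rw [Algebra.adjoin_eq_span, Submonoid.closure_eq]
    have : Module.Finite (ZMod 2) (Subalgebra.toSubmodule S) := by
      rw [h]
      exact Module.Finite.span_of_finite _ hU
    exact Module.finite_of_finite (ZMod 2) (M := Subalgebra.toSubmodule S)
  have hmem : ∀ u : Rˣ, (u : R) ∈ S := fun u => Algebra.subset_adjoin u.isUnit
  refine ⟨S, inferInstance, hfin, charP_of_injective_algebraMap (algebraMap (ZMod 2) S).injective 2, ⟨?_⟩⟩
  exact
    { toFun := fun u => ⟨⟨u, hmem u⟩, ⟨(u⁻¹ : Rˣ), hmem _⟩, by ext; simp, by ext; simp⟩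
      invFun := Units.map (S.val : S →* R)
      left_inv := fun u => by ext; rfl
      right_inv := fun u => by ext; rfl
      map_mul' := fun u v => by ext; rfl }

/-- If `G` is a finite group with trivial 2-core (every normal 2-subgroup is trivial)
which is isomorphic to the unit group of some ring, then `G` is isomorphic to a finite
direct product of general linear groups over finite fields of characteristic 2. -/
theorem stmt_0 (G : Type) [Group G] [Finite G]
    (h2core : ∀ N : Subgroup G, N.Normal → IsPGroup 2 N → N = ⊥)
    (hunits : ∃ (R : Type) (_ : Ring R), Nonempty (G ≃* Rˣ)) :
    ∃ (r : ℕ) (n k : Fin r → ℕ), (∀ i, 1 ≤ n i) ∧ (∀ i, 1 ≤ k i) ∧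
      Nonempty (G ≃* ∀ i : Fin r,
        Matrix.GeneralLinearGroup (Fin (n i)) (GaloisField 2 (k i))) := by
  obtain ⟨R, _, ⟨e⟩⟩ := hunits
  have h2 := aux_neg_one R (aux_core e h2core)
  have : Finite Rˣ := Finite.of_equiv G e.toEquiv
  rcases subsingleton_or_nontrivial R with hR | hR
  · obtain ⟨r, n, k, hn, hk, ⟨f⟩⟩ := aux_semisimple R h2
    exact ⟨r, n, k, hn, hk, ⟨e.trans f⟩⟩
  · have : CharP R 2 := CharTwo.of_one_ne_zero_of_two_eq_zero one_ne_zero h2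
    obtain ⟨S, _, _, _, ⟨g⟩⟩ := aux_sub R
    have := aux_jacobson S (aux_core (e.trans g) h2core)
    obtain ⟨r, n, k, hn, hk, ⟨f⟩⟩ := aux_semisimple S CharTwo.two_eq_zero
    exact ⟨r, n, k, hn, hk, ⟨(e.trans g).trans f⟩⟩
end

section
/- Let G be a finite simple group that is isomorphic to the unit group of some ring. Then G is isomorphic to one of: (a) the cyclic group ℤ/2ℤ; (b) a cyclic group ℤ/pℤ where p = 2^k − 1 is a Mersenne prime for some k ≥ 2; or (c) the projective special linear group PSL_n(F₂) for some n ≥ 3. -/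
theorem aux_prime (G : Type) [Group G] [Finite G] [IsSimpleGroup G] (z : G) (hz : z ≠ 1)
    (hc : ∀ g, g * z = z * g) : (Nat.card G).Prime := by
  have h : Subgroup.center G = ⊤ := by
    refine (Subgroup.Normal.eq_bot_or_eq_top (H := Subgroup.center G) inferInstance).resolve_left ?_
    intro h
    have : z ∈ Subgroup.center G := Subgroup.mem_center_iff.2 hc
    rw [h] at this
    exact hz (by simpa using this)
  have : IsMulCommutative G := ⟨⟨fun a b => by
    have : b ∈ Subgroup.center G := by rw [h]; trivial
    exact Subgroup.mem_center_iff.1 this a⟩⟩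
  exact Group.is_simple_iff_prime_card.1 inferInstance

theorem aux_iso (G : Type) [Group G] (p : ℕ) (hp : p.Prime) (h : Nat.card G = p) :
    Nonempty (G ≃* Multiplicative (ZMod p)) := by
  have := Fact.mk hp
  exact ⟨mulEquivOfPrimeCardEq (p := p) h (by simp)⟩

theorem aux_two (G : Type) [Group G] [Finite G] [IsSimpleGroup G] (z : G) (hz : z ≠ 1)
    (hc : ∀ g, g * z = z * g) (hp : IsPGroup 2 (Subgroup.zpowers z)) :
    Nonempty (G ≃* Multiplicative (ZMod 2)) := by
  have h1 := aux_prime G z hz hc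
  apply aux_iso G 2 Nat.prime_two
  obtain ⟨k, hk⟩ := hp ⟨z, Subgroup.mem_zpowers z⟩
  have hk' : z ^ 2 ^ k = 1 := by simpa [Subtype.ext_iff] using hk
  have h2 := orderOf_dvd_of_pow_eq_one hk'
  have h3 : orderOf z = Nat.card G :=
    ((Nat.dvd_prime h1).1 (orderOf_dvd_natCard z)).resolve_left (by simpa using hz)
  rw [h3] at h2
  exact (Nat.prime_dvd_prime_iff_eq h1 Nat.prime_two).1 (h1.dvd_of_dvd_pow h2)

theorem aux_S3 : ¬ IsSimpleGroup (Matrix.SpecialLinearGroup (Fin 2) (ZMod 2)) := by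
  intro h
  have hc : Nat.card (Matrix.SpecialLinearGroup (Fin 2) (ZMod 2)) = 6 := by
    rw [Nat.card_eq_fintype_card]; decide
  let z : Matrix.SpecialLinearGroup (Fin 2) (ZMod 2) := ⟨!![0,1;1,1], by decide⟩
  have hz : orderOf z = 3 := by
    have : Fact (Nat.Prime 3) := ⟨Nat.prime_three⟩
    exact orderOf_eq_prime (by decide) (fun h => absurd (congrArg Subtype.val h) (by decide))
  have h3 : Nat.card (Subgroup.zpowers z) = 3 := by rw [Nat.card_zpowers, hz]
  have hi : (Subgroup.zpowers z).index = 2 := by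
    have := (Subgroup.zpowers z).card_mul_index
    rw [hc, h3] at this; omega
  rcases (Subgroup.normal_of_index_eq_two hi).eq_bot_or_eq_top with h | h <;> rw [h] at hi h3
  · simp at h3
  · simp at hi

theorem aux_SL (n : ℕ) (hs : IsSimpleGroup (Matrix.SpecialLinearGroup (Fin n) (ZMod 2))) :
    3 ≤ n ∧ Nonempty (Matrix.SpecialLinearGroup (Fin n) (ZMod 2) ≃*
      (Matrix.SpecialLinearGroup (Fin n) (ZMod 2) ⧸
        Subgroup.center (Matrix.SpecialLinearGroup (Fin n) (ZMod 2)))) := by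
  constructor
  · by_contra hn
    have : n = 0 ∨ n = 1 ∨ n = 2 := by omega
    rcases this with rfl | rfl | rfl
    · exact not_nontrivial _ hs.toNontrivial
    · exact not_nontrivial _ hs.toNontrivial
    · exact aux_S3 hs
  · have : Subgroup.center (Matrix.SpecialLinearGroup (Fin n) (ZMod 2)) = ⊥ := by
      rw [eq_bot_iff]
      intro A hA
      obtain ⟨r, hr, hA⟩ := Matrix.SpecialLinearGroup.mem_center_iff.1 hA
      rw [Subgroup.mem_bot]
      apply Subtype.ext
      rw [← hA]
      have : ∀ r : ZMod 2, r = 0 ∨ r = 1 := by decide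
      have := this r
      rcases this with rfl | rfl
      · have hn : n = 0 := by
          by_contra h
          simp [h] at hr
        subst hn
        exact Subsingleton.elim _ _
      · simp
    exact ⟨(QuotientGroup.quotientBot.symm).trans (QuotientGroup.quotientMulEquivOfEq this.symm)⟩

theorem aux_GL (n : ℕ) (F : Type) [Field F] (hF : Nat.card F = 2) :
    Nonempty ((Matrix (Fin n) (Fin n) F)ˣ ≃* Matrix.SpecialLinearGroup (Fin n) (ZMod 2)) := by
  have : Finite F := Nat.finite_of_card_ne_zero (by omega)
  have := Fintype.ofFinite F
  have hF' : Fintype.card F = 2 := by rw [← Nat.card_eq_fintype_card, hF]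
  let e : F ≃+* ZMod 2 := (ZMod.ringEquivOfPrime F Nat.prime_two hF').symm
  let f : Matrix.SpecialLinearGroup (Fin n) (ZMod 2) →* (Matrix (Fin n) (Fin n) (ZMod 2))ˣ :=
    Matrix.SpecialLinearGroup.toGL
  refine ⟨(Units.mapEquiv e.mapMatrix.toMulEquiv).trans (MulEquiv.ofBijective f ⟨?_, ?_⟩).symm⟩
  · exact Matrix.SpecialLinearGroup.toGL_injective
  · intro u
    refine ⟨⟨u.1, ?_⟩, ?_⟩
    · have h : IsUnit (u.1).det := (Matrix.isUnit_iff_isUnit_det _).1 u.isUnit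
      have : ∀ x : ZMod 2, x ≠ 0 → x = 1 := by decide
      exact this _ h.ne_zero
    · ext1; rfl

theorem aux_scalar (n : ℕ) [NeZero n] {D : Type} [DivisionRing D] :
    Function.Injective (Matrix.scalar (Fin n) : D →+* Matrix (Fin n) (Fin n) D) := by
  intro a b h
  have := congrFun (congrFun h 0) 0
  simpa using this

abbrev Concl (G : Type) [Group G] : Prop :=
    Nonempty (G ≃* Multiplicative (ZMod 2)) ∨
    (∃ k : ℕ, 2 ≤ k ∧ Nat.Prime (2 ^ k - 1) ∧
      Nonempty (G ≃* Multiplicative (ZMod (2 ^ k - 1)))) ∨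
    (∃ n : ℕ, 3 ≤ n ∧ Nonempty (G ≃*
      (Matrix.SpecialLinearGroup (Fin n) (ZMod 2) ⧸
        Subgroup.center (Matrix.SpecialLinearGroup (Fin n) (ZMod 2)))))

theorem Concl.congr {G H : Type} [Group G] [Group H] (e : G ≃* H) (h : Concl H) : Concl G := by
  rcases h with ⟨⟨f⟩⟩ | ⟨k, h1, h2, ⟨f⟩⟩ | ⟨n, h1, ⟨f⟩⟩
  · exact .inl ⟨e.trans f⟩
  · exact .inr (.inl ⟨k, h1, h2, ⟨e.trans f⟩⟩)
  · exact .inr (.inr ⟨n, h1, ⟨e.trans f⟩⟩)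

theorem aux_matrix (n : ℕ) [NeZero n] (F : Type) [Field F] [Finite F] (h2 : (2 : F) = 0)
    (hs : IsSimpleGroup (Matrix (Fin n) (Fin n) F)ˣ) : Concl (Matrix (Fin n) (Fin n) F)ˣ := by
  classical
  by_cases hF : Nat.card F = 2
  · obtain ⟨e⟩ := aux_GL n F hF
    have := e.symm.isSimpleGroup
    obtain ⟨h3, ⟨f⟩⟩ := aux_SL n this
    exact .inr (.inr ⟨n, h3, ⟨e.trans f⟩⟩)
  · have := Fintype.ofFinite F
    have : CharP F 2 := CharTwo.of_one_ne_zero_of_two_eq_zero one_ne_zero h2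
    obtain ⟨k, -, hk⟩ := FiniteField.card F 2
    rw [Nat.card_eq_fintype_card, hk] at hF
    have hk2 : 2 ≤ (k : ℕ) := by
      have := k.pos
      by_contra h
      have : (k : ℕ) = 1 := by omega
      rw [this] at hF; exact hF rfl
    have h4 : 2 ^ 2 ≤ 2 ^ (k : ℕ) := Nat.pow_le_pow_right (by norm_num) hk2
    let f : Fˣ →* (Matrix (Fin n) (Fin n) F)ˣ := Units.map (Matrix.scalar (Fin n)).toMonoidHom
    have hf : Function.Injective f := by
      apply Units.map_injective
      exact aux_scalar n
    have hcF : Nat.card Fˣ = 2 ^ (k : ℕ) - 1 := by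
      rw [Nat.card_eq_fintype_card, Fintype.card_units, hk]
    have hnt : Nontrivial Fˣ := by
      rw [← Finite.one_lt_card_iff_nontrivial, hcF]; omega
    obtain ⟨x, hx⟩ := exists_ne (1 : Fˣ)
    have hp := aux_prime _ (f x) (fun h => hx (hf (by simpa using h))) (by
      intro g
      ext1
      exact ((Matrix.scalar_commute (x : F) (fun r => mul_comm _ _) (g : Matrix (Fin n) (Fin n) F)).eq).symm)
    have hd := Subgroup.card_dvd_of_injective f hf
    have he := ((Nat.dvd_prime hp).1 hd).resolve_left (by omega)
    rw [hcF] at he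
    refine .inr (.inl ⟨k, hk2, he ▸ hp, aux_iso _ _ (he ▸ hp) he.symm⟩)

theorem aux_semisimple_s2 (S : Type) [Ring S] [Finite S] [IsSemisimpleRing S] (h2 : (2 : S) = 0)
    (hs : IsSimpleGroup Sˣ) : Concl Sˣ := by
  obtain ⟨m, D, d, _, _, ⟨e⟩⟩ := IsSemisimpleRing.exists_ringEquiv_pi_matrix_divisionRing S
  let E : Sˣ ≃* (∀ i, (Matrix (Fin (d i)) (Fin (d i)) (D i))ˣ) :=
    (Units.mapEquiv e.toMulEquiv).trans MulEquiv.piUnits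
  have hex : ∃ i, Nontrivial (Matrix (Fin (d i)) (Fin (d i)) (D i))ˣ := by
    by_contra! h
    exact not_nontrivial_iff_subsingleton.2 (E.toEquiv.subsingleton) hs.toNontrivial
  obtain ⟨i, hi⟩ := hex
  let p : S →+* Matrix (Fin (d i)) (Fin (d i)) (D i) := (Pi.evalRingHom _ i).comp e.toRingHom
  have hp : Function.Surjective p := (Function.surjective_eval i).comp e.surjective
  have : Finite (Matrix (Fin (d i)) (Fin (d i)) (D i)) := Finite.of_surjective p hp
  have : Finite (D i) := Finite.of_injective (Matrix.scalar (Fin (d i)) : D i → _)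
    (aux_scalar (d i))
  have h2' : (2 : D i) = 0 := by
    have : (2 : Matrix (Fin (d i)) (Fin (d i)) (D i)) = 0 := by
      rw [← map_ofNat p 2, h2, map_zero]
    apply aux_scalar (d i)
    rw [map_ofNat, this, map_zero]
  let q : Sˣ →* (Matrix (Fin (d i)) (Fin (d i)) (D i))ˣ := (Pi.evalMonoidHom _ i).comp E.toMonoidHom
  have hq : Function.Surjective q := (Function.surjective_eval i).comp E.surjective
  have hqi : Function.Injective q := by
    rw [← MonoidHom.ker_eq_bot_iff]
    refine (q.normal_ker.eq_bot_or_eq_top).resolve_right fun h => ?_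
    obtain ⟨y, hy⟩ := exists_ne (1 : (Matrix (Fin (d i)) (Fin (d i)) (D i))ˣ)
    obtain ⟨x, rfl⟩ := hq y
    apply hy
    rw [← MonoidHom.mem_ker, h]; trivial
  let Q := MulEquiv.ofBijective q ⟨hqi, hq⟩
  apply Concl.congr Q
  exact @aux_matrix (d i) _ (D i) (littleWedderburn (D i)) _ h2' Q.symm.isSimpleGroup

theorem aux_finite (S : Type) [Ring S] [Finite S] (h2 : (2 : S) = 0)
    (hs : IsSimpleGroup Sˣ) : Concl Sˣ := by
  have hnil : IsNilpotent (Ring.jacobson S) := IsSemiprimaryRing.isNilpotent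
  have hx : ∀ x ∈ Ring.jacobson S, IsNilpotent x := by
    obtain ⟨k, hk⟩ := hnil
    intro x hx
    refine ⟨k, ?_⟩
    have := Ideal.pow_mem_pow hx k
    rw [hk] at this
    simpa using this
  let q : Sˣ →* (S ⧸ Ring.jacobson S)ˣ := Units.map (Ideal.Quotient.mk (Ring.jacobson S)).toMonoidHom
  have hq : ∀ u : Sˣ, u ∈ q.ker ↔ (u : S) - 1 ∈ Ring.jacobson S := by
    intro u
    rw [MonoidHom.mem_ker, Units.ext_iff, ← Ideal.Quotient.eq]
    simp [q]
  rcases q.normal_ker.eq_bot_or_eq_top with h | h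
  · have hJ : Ring.jacobson S = ⊥ := by
      rw [eq_bot_iff]
      intro x hxJ
      obtain ⟨u, hu⟩ := (hx x hxJ).isUnit_one_add
      have : u ∈ q.ker := by rw [hq, hu]; simpa using hxJ
      rw [h, Subgroup.mem_bot] at this
      rw [this] at hu
      simpa using hu
    have : IsSemisimpleRing S := IsArtinianRing.isSemisimpleRing_iff_jacobson.2 hJ
    exact aux_semisimple_s2 S h2 hs
  · left
    have : Nontrivial S := by
      by_contra hn
      rw [not_nontrivial_iff_subsingleton] at hn
      exact not_nontrivial _ hs.toNontrivial
    have : CharP S 2 := CharTwo.of_one_ne_zero_of_two_eq_zero one_ne_zero h2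
    have hP : IsPGroup 2 Sˣ := by
      intro u
      have hu : (u : S) - 1 ∈ Ring.jacobson S := by rw [← hq, h]; trivial
      obtain ⟨k, hk⟩ := hx _ hu
      refine ⟨k, ?_⟩
      have h1 : ((u : S) - 1) ^ 2 ^ k = 0 := pow_eq_zero_of_le Nat.lt_two_pow_self.le hk
      rw [sub_pow_char_pow_of_commute _ _ (Commute.one_right _)] at h1
      ext1
      simpa [sub_eq_zero] using h1
    have : Nontrivial (Subgroup.center Sˣ) := hP.center_nontrivial
    obtain ⟨z, hz⟩ := exists_ne (1 : Subgroup.center Sˣ)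
    exact aux_two _ (z : Sˣ) (by simpa using hz) (fun g => Subgroup.mem_center_iff.1 z.2 g)
      (hP.to_subgroup _)

theorem aux_char2 (R : Type) [Ring R] [Finite Rˣ] (h2 : (2 : R) = 0)
    (hs : IsSimpleGroup Rˣ) : Concl Rˣ := by
  have : Nontrivial R := by
    by_contra hn
    rw [not_nontrivial_iff_subsingleton] at hn
    exact not_nontrivial _ hs.toNontrivial
  have : CharP R 2 := CharTwo.of_one_ne_zero_of_two_eq_zero one_ne_zero h2
  let := ZMod.algebra R 2
  let M := IsUnit.submonoid R
  let S := Algebra.adjoin (ZMod 2) (M : Set R)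
  have hM : (M : Set R).Finite := by
    refine (Set.finite_range (Units.val : Rˣ → R)).subset ?_
    rintro x ⟨u, rfl⟩
    exact ⟨u, rfl⟩
  have hS : Finite S := by
    have hspan : Subalgebra.toSubmodule S = Submodule.span (ZMod 2) (M : Set R) := by
      rw [Algebra.adjoin_eq_span, Submonoid.closure_eq]
    have : Module.Finite (ZMod 2) (Submodule.span (ZMod 2) (M : Set R)) :=
      Module.Finite.span_of_finite _ hM
    have : Finite (Submodule.span (ZMod 2) (M : Set R)) := Module.finite_of_finite (ZMod 2)
    rw [← hspan] at this
    exact this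
  let f : Sˣ →* Rˣ := Units.map S.val.toRingHom.toMonoidHom
  have hf : Function.Bijective f := by
    constructor
    · exact Units.map_injective Subtype.val_injective
    · intro u
      refine ⟨⟨⟨u, Algebra.subset_adjoin u.isUnit⟩, ⟨(u⁻¹ : Rˣ), Algebra.subset_adjoin (u⁻¹).isUnit⟩,
        ?_, ?_⟩, ?_⟩
      · ext1; simp
      · ext1; simp
      · ext1; rfl
  let e := MulEquiv.ofBijective f hf
  have h2' : (2 : S) = 0 := by
    apply Subtype.ext
    exact h2
  exact Concl.congr e.symm (aux_finite S h2' e.isSimpleGroup)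

theorem stmt_2 (G : Type) [Group G] [Finite G] [IsSimpleGroup G]
    (hunits : ∃ (R : Type) (_ : Ring R), Nonempty (G ≃* Rˣ)) :
    Nonempty (G ≃* Multiplicative (ZMod 2)) ∨
    (∃ k : ℕ, 2 ≤ k ∧ Nat.Prime (2 ^ k - 1) ∧
      Nonempty (G ≃* Multiplicative (ZMod (2 ^ k - 1)))) ∨
    (∃ n : ℕ, 3 ≤ n ∧ Nonempty (G ≃*
      (Matrix.SpecialLinearGroup (Fin n) (ZMod 2) ⧸
        Subgroup.center (Matrix.SpecialLinearGroup (Fin n) (ZMod 2))))) := by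
  obtain ⟨R, _, ⟨e⟩⟩ := hunits
  have hs : IsSimpleGroup Rˣ := e.symm.isSimpleGroup
  have : Finite Rˣ := Finite.of_equiv G e.toEquiv
  refine Concl.congr e ?_
  by_cases h2 : (2 : R) = 0
  · exact aux_char2 R h2 hs
  · left
    refine aux_two Rˣ (-1) ?_ ?_ ?_
    · intro h
      apply h2
      have h' : (-1 : R) = 1 := by simpa using congrArg Units.val h
      rw [← one_add_one_eq_two]
      nth_rewrite 1 [← h']
      simp
    · intro g; simp
    · rintro ⟨x, n, rfl⟩
      refine ⟨1, ?_⟩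
      ext1
      simp only [pow_one, Subgroup.coe_pow, Subgroup.coe_one]
      rw [← zpow_natCast, zpow_comm]
      simp
end

section
/- Let G be a finite group, let R be a ring of characteristic 2, and fix a group isomorphism G ≅ Rˣ. Let φ : F₂[G] → R be the ring homomorphism from the group algebra of G over F₂ induced by this isomorphism, and let S be the image of φ, a subring of R. Then the unit group of S is isomorphic to G. -/
/-- Let G be a finite group, R a ring of characteristic 2, and e : G ≃* Rˣ a group
isomorphism.  If φ : F₂[G] → R is the induced ring homomorphism from the group algebra
(i.e. φ sends each group element g to the unit e g), then the unit group of the image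
subring S = φ.range is isomorphic to G. -/
theorem stmt_6 (G : Type) [Group G] [Finite G]
    (R : Type) [Ring R] (hchar : (1 : R) + 1 = 0)
    (e : G ≃* Rˣ)
    (φ : MonoidAlgebra (ZMod 2) G →+* R)
    (hφ : ∀ g : G, φ (MonoidAlgebra.of (ZMod 2) G g) = (e g : R)) :
    Nonempty ((↥φ.range)ˣ ≃* G) := by
  have hmem : ∀ u : Rˣ, (u : R) ∈ φ.range := fun u =>
    ⟨MonoidAlgebra.of (ZMod 2) G (e.symm u), by rw [hφ]; simp⟩
  let f : (↥φ.range)ˣ →* Rˣ := Units.map (φ.range.subtype : ↥φ.range →* R)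
  have hf : Function.Bijective f := by
    constructor
    · exact Units.map_injective Subtype.val_injective
    · intro u
      exact ⟨⟨⟨u, hmem u⟩, ⟨((u⁻¹ : Rˣ) : R), hmem u⁻¹⟩, Subtype.ext u.mul_inv,
        Subtype.ext u.inv_mul⟩, Units.ext rfl⟩
  exact ⟨(MulEquiv.ofBijective f hf).trans e.symm⟩
end

section
/- Let R be a finite ring of characteristic 2 such that the unit group Rˣ has trivial 2-core (i.e., the only normal subgroup of Rˣ that is a 2-group is the trivial subgroup). Then every two-sided ideal J of R with J² = 0 is the zero ideal. -/
/-- In a finite ring of characteristic 2 whose unit group has trivial 2-core, every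
two-sided ideal J with J² = 0 is the zero ideal. -/
theorem stmt_9 (R : Type) [Ring R] [Finite R] (hchar : (1 : R) + 1 = 0)
    (h2core : ∀ N : Subgroup Rˣ, N.Normal → IsPGroup 2 N → N = ⊥)
    (J : TwoSidedIdeal R) (hJ : ∀ a ∈ J, ∀ b ∈ J, a * b = 0) :
    J = ⊥ := by
  have h2 : ∀ x : R, x + x = 0 := fun x => by
    have : x + x = (1 + 1) * x := by noncomm_ring
    rw [this, hchar, zero_mul]
  let N : Subgroup Rˣ :=
    { carrier := {u | (u : R) - 1 ∈ J}
      one_mem' := by simpa using J.zero_mem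
      mul_mem' := by
        intro a b ha hb
        have e : ((a * b : Rˣ) : R) - 1 = (a : R) * ((b : R) - 1) + ((a : R) - 1) := by
          push_cast; noncomm_ring
        change ((a * b : Rˣ) : R) - 1 ∈ J
        rw [e]
        exact J.add_mem (J.mul_mem_left _ _ hb) ha
      inv_mem' := by
        intro a ha
        have e : ((a⁻¹ : Rˣ) : R) - 1 = -(((a⁻¹ : Rˣ) : R) * ((a : R) - 1)) := by
          rw [mul_sub, Units.inv_mul, mul_one, neg_sub]
        change ((a⁻¹ : Rˣ) : R) - 1 ∈ J
        rw [e]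
        exact J.neg_mem (J.mul_mem_left _ _ ha) }
  have hN : N = ⊥ := by
    apply h2core
    · constructor
      intro n hn g
      have e : ((g * n * g⁻¹ : Rˣ) : R) - 1 = (g : R) * ((n : R) - 1) * ((g⁻¹ : Rˣ) : R) := by
        rw [mul_sub, sub_mul, mul_one, Units.mul_inv]; push_cast; rfl
      change ((g * n * g⁻¹ : Rˣ) : R) - 1 ∈ J
      rw [e]
      exact J.mul_mem_right _ _ (J.mul_mem_left _ _ hn)
    · rintro ⟨u, hu⟩
      refine ⟨1, ?_⟩
      apply Subtype.ext
      apply Units.ext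
      have h := hJ _ hu _ hu
      have h3 := h2 (u : R)
      have h4 := hchar
      have e : (u : R) * u = ((u : R) - 1) * ((u : R) - 1) + ((u : R) + u) - (1 + 1) + 1 := by
        noncomm_ring
      rw [h, h3, h4] at e
      simpa [pow_two] using e
  rw [eq_bot_iff]
  intro x hx
  have hm : (1 + x) * (1 + x) = 1 := by
    have e : (1 + x) * (1 + x) = 1 + (x + x) + x * x := by noncomm_ring
    rw [e, h2, hJ x hx x hx]; simp
  let u : Rˣ := ⟨1 + x, 1 + x, hm, hm⟩
  have hu : u ∈ N := by
    change (1 + x) - 1 ∈ J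
    simpa using hx
  rw [hN, Subgroup.mem_bot] at hu
  have h := congrArg Units.val hu
  have hx0 : x = 0 := by simpa [u] using h
  rw [hx0]
  exact TwoSidedIdeal.zero_mem _
end

section
/- The alternating group A₈ on eight letters is isomorphic to the unit group of a ring; indeed, A₈ ≅ PSL₄(F₂) = GL₄(F₂), which is the unit group of the matrix ring M₄(F₂). -/
open Matrix

namespace KerdockA8

/-- A set of eight alternating matrices, all of whose pairwise differences are invertible. -/
def B : Fin 8 → Matrix (Fin 4) (Fin 4) (ZMod 2) :=
  ![!![0, 0, 0, 0; 0, 0, 0, 0; 0, 0, 0, 0; 0, 0, 0, 0],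
  !![0, 0, 0, 1; 0, 0, 1, 0; 0, 1, 0, 0; 1, 0, 0, 0],
  !![0, 0, 1, 1; 0, 0, 0, 1; 1, 0, 0, 0; 1, 1, 0, 0],
  !![0, 1, 1, 0; 1, 0, 1, 1; 1, 1, 0, 0; 0, 1, 0, 0],
  !![0, 1, 1, 1; 1, 0, 0, 0; 1, 0, 0, 1; 1, 0, 1, 0],
  !![0, 1, 0, 0; 1, 0, 1, 0; 0, 1, 0, 1; 0, 0, 1, 0],
  !![0, 1, 0, 1; 1, 0, 0, 1; 0, 0, 0, 1; 1, 1, 1, 0],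
  !![0, 0, 1, 0; 0, 0, 1, 1; 1, 1, 0, 1; 0, 1, 1, 0]]

/-- The permutation of the eight matrices induced by the transvection at position `(i, j)`. -/
def tab : Fin 4 → Fin 4 → Fin 8 → Fin 8 :=
  ![![![0, 1, 2, 3, 4, 5, 6, 7], ![4, 5, 6, 7, 0, 1, 2, 3], ![2, 3, 0, 1, 6, 7, 4, 5], ![1, 0, 3, 2, 5, 4, 7, 6]],
  ![![5, 6, 4, 7, 2, 0, 1, 3], ![0, 1, 2, 3, 4, 5, 6, 7], ![1, 0, 3, 2, 7, 6, 5, 4], ![3, 2, 1, 0, 6, 7, 4, 5]],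
  ![![7, 2, 1, 5, 6, 3, 4, 0], ![1, 0, 7, 6, 5, 4, 3, 2], ![0, 1, 2, 3, 4, 5, 6, 7], ![5, 4, 6, 7, 1, 0, 2, 3]],
  ![![1, 0, 7, 4, 3, 6, 5, 2], ![2, 7, 0, 5, 6, 3, 4, 1], ![6, 5, 4, 7, 2, 1, 0, 3], ![0, 1, 2, 3, 4, 5, 6, 7]]]

/-- Coordinates of the elementary alternating matrices in terms of `B`. -/
def co : Fin 4 → Fin 4 → List (Fin 8) :=
  ![![[], [1, 2, 3], [1, 4, 5], [2, 4, 6]],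
  ![[1, 2, 3], [], [1, 2, 4, 6], [1, 5, 6]],
  ![[1, 4, 5], [1, 2, 4, 6], [], [3, 4, 5, 6]],
  ![[2, 4, 6], [1, 5, 6], [3, 4, 5, 6], []]]

lemma tab_tab : ∀ i j k, tab i j (tab i j k) = k := by decide +kernel

/-- `tab` as a permutation. -/
def perm (i j : Fin 4) : Equiv.Perm (Fin 8) :=
  ⟨tab i j, tab i j, tab_tab i j, tab_tab i j⟩

lemma sign_perm : ∀ i j, Equiv.Perm.sign (perm i j) = 1 := by decide +kernel

/-- Elementary alternating matrix. -/
def E (a b : Fin 4) : Matrix (Fin 4) (Fin 4) (ZMod 2) :=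
  Matrix.of fun c d => if (c = a ∧ d = b) ∨ (c = b ∧ d = a) then 1 else 0

lemma co_spec : ∀ a b, a ≠ b → ((co a b).map B).sum = E a b := by decide +kernel

/-- Compatibility of a matrix and a permutation. -/
def Compat (g : Matrix (Fin 4) (Fin 4) (ZMod 2)) (σ : Equiv.Perm (Fin 8)) : Prop :=
  ∀ i j, g * (B i + B j) * gᵀ = B (σ i) + B (σ j)

lemma compat_tab : ∀ a b, a ≠ b → ∀ i j,
    transvection a b (1 : ZMod 2) * (B i + B j) * (transvection a b (1 : ZMod 2))ᵀ
      = B (tab a b i) + B (tab a b j) := by decide +kernel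

lemma B_inj : ∀ i j, i ≠ j → ∀ a b, B a + B b = B i + B j → a = i ∨ a = j := by
  decide +kernel

lemma Compat.mul {g h σ τ} (hg : Compat g σ) (hh : Compat h τ) : Compat (g * h) (σ * τ) := by
  intro i j
  have := hg (τ i) (τ j)
  rw [← hh i j] at this
  simpa [Matrix.transpose_mul, Matrix.mul_assoc] using this

lemma compat_one : Compat 1 1 := by intro i j; simp

lemma exists_compat (M : Matrix (Fin 4) (Fin 4) (ZMod 2)) (hM : M.det ≠ 0) :
    ∃ σ ∈ alternatingGroup (Fin 8), Compat M σ := by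
  refine diagonal_transvection_induction_of_det_ne_zero
    (fun M => ∃ σ ∈ alternatingGroup (Fin 8), Compat M σ) M hM ?_ ?_ ?_
  · intro D hD
    have h : D = fun _ => 1 := by
      funext i
      rw [det_diagonal, Finset.prod_ne_zero_iff] at hD
      have := hD i (Finset.mem_univ _)
      revert this
      generalize D i = x
      revert x
      decide
    refine ⟨1, one_mem _, ?_⟩
    rw [h, diagonal_one]
    exact compat_one
  · rintro ⟨i, j, hij, c⟩
    have hc : c = 0 ∨ c = 1 := by revert c; decide
    rcases hc with rfl | rfl
    · refine ⟨1, one_mem _, ?_⟩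
      simpa [TransvectionStruct.toMatrix] using compat_one
    · exact ⟨perm i j, Equiv.Perm.mem_alternatingGroup.2 (sign_perm i j), compat_tab i j hij⟩
  · rintro A C - - ⟨σ, hσ, h1⟩ ⟨τ, hτ, h2⟩
    exact ⟨σ * τ, mul_mem hσ hτ, h1.mul h2⟩

lemma eq_one_of_compat_one {σ} (h : Compat 1 σ) : σ = 1 := by
  ext i : 1
  have key : ∀ j, i ≠ j → σ i = i ∨ σ i = j := fun j hj =>
    B_inj i j hj (σ i) (σ j) (by rw [← h i j]; simp)
  have : ∀ i s : Fin 8, (∀ j, i ≠ j → s = i ∨ s = j) → s = i := by decide +kernel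
  exact this i (σ i) key

lemma bits1 : ∀ xa xb xk ya yb yk : ZMod 2, xa * yb + xb * ya = 1 → xa * yk + xk * ya = 0 →
    xk * yb + xb * yk = 0 → xk = 0 := by decide +kernel

lemma bits2 : ∀ xa xb ya yb : ZMod 2, xa * yb + xb * ya = 1 → xb = 0 → xa = 1 := by
  decide +kernel

lemma exists_third : ∀ a k : Fin 4, ∃ b, b ≠ a ∧ b ≠ k := by decide

lemma mat_eq_one {g} (h : Compat g 1) : g = 1 := by
  have hB : ∀ i, g * B i * gᵀ = B i := by
    intro i
    have h0 : B 0 = 0 := by decide +kernel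
    simpa [h0] using h i 0
  have hl : ∀ l : List (Fin 8), g * (l.map B).sum * gᵀ = (l.map B).sum := by
    intro l
    induction l with
    | nil => simp
    | cons x l ih => simp [mul_add, add_mul, hB, ih]
  have hE : ∀ a b, a ≠ b → ∀ c d, g c a * g d b + g c b * g d a = E a b c d := by
    intro a b hab c d
    have h1 := hl (co a b)
    rw [co_spec a b hab] at h1
    have h2 := congrFun (congrFun h1 c) d
    rw [← h2]
    have : E a b = single a b 1 + single b a 1 := by
      clear h1 h2; revert a b; decide +kernel
    rw [this]
    simp [mul_add, add_mul, Matrix.mul_apply, Matrix.single_apply, Finset.sum_add_distrib, ite_and]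
  have off : ∀ a k, k ≠ a → g k a = 0 := by
    intro a k hk
    obtain ⟨b, hb, hbk⟩ := exists_third a k
    refine bits1 (g a a) (g b a) (g k a) (g a b) (g b b) (g k b) ?_ ?_ ?_
    · have := hE a b hb.symm a b
      simp [E] at this
      linear_combination this
    · have := hE a b hb.symm a k
      simp [E, hk, hb.symm, hbk.symm] at this
      linear_combination this
    · have := hE a b hb.symm k b
      simp [E, hk, hb, hbk.symm] at this
      linear_combination this
  ext k a
  by_cases hk : k = a
  · subst hk
    obtain ⟨b, hb, -⟩ := exists_third k k
    rw [one_apply_eq]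
    refine bits2 (g k k) (g b k) (g k b) (g b b) ?_ (off k b hb)
    have := hE k b hb.symm k b
    simp [E] at this
    linear_combination this
  · rw [one_apply_ne hk]
    exact off a k hk

/-- The graph of the isomorphism. -/
def S : Subgroup ((Matrix (Fin 4) (Fin 4) (ZMod 2))ˣ × alternatingGroup (Fin 8)) where
  carrier := {p | Compat p.1 p.2}
  one_mem' := compat_one
  mul_mem' := fun ha hb => Compat.mul ha hb
  inv_mem' := by
    rintro ⟨g, σ⟩ h i j
    have h1 := h (σ⁻¹.1 i) (σ⁻¹.1 j)
    have h2 : ∀ k, σ.1 (σ⁻¹.1 k) = k := fun k => by simp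
    simp only [h2] at h1
    change (↑g⁻¹ : Matrix (Fin 4) (Fin 4) (ZMod 2)) * (B i + B j) * (↑g⁻¹ : Matrix _ _ _)ᵀ = _
    rw [← h1]
    have h3 : (↑g : Matrix (Fin 4) (Fin 4) (ZMod 2))ᵀ * (↑g⁻¹ : Matrix _ _ _)ᵀ = 1 := by
      rw [← transpose_mul, Units.inv_mul, transpose_one]
    rw [Matrix.mul_assoc, Matrix.mul_assoc, h3, Matrix.mul_one, ← Matrix.mul_assoc, Units.inv_mul,
      Matrix.one_mul]
    rfl

/-- First projection. -/
def p1 : S →* (Matrix (Fin 4) (Fin 4) (ZMod 2))ˣ := (MonoidHom.fst _ _).comp S.subtype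

/-- Second projection. -/
def p2 : S →* alternatingGroup (Fin 8) := (MonoidHom.snd _ _).comp S.subtype

lemma p1_bij : Function.Bijective p1 := by
  constructor
  · rw [injective_iff_map_eq_one]
    rintro ⟨⟨g, σ⟩, h⟩ (rfl : g = 1)
    have : σ = 1 := Subtype.ext (eq_one_of_compat_one h)
    subst this
    rfl
  · intro g
    obtain ⟨σ, hσ, h⟩ := exists_compat g.1 (by
      have := (isUnit_iff_isUnit_det g.1).1 g.isUnit
      exact this.ne_zero)
    exact ⟨⟨(g, ⟨σ, hσ⟩), h⟩, rfl⟩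

lemma p2_inj : Function.Injective p2 := by
  rw [injective_iff_map_eq_one]
  rintro ⟨⟨g, σ⟩, h⟩ (rfl : σ = 1)
  have : g = 1 := Units.ext (mat_eq_one h)
  subst this
  rfl

lemma card_eq : Nat.card S = Nat.card (alternatingGroup (Fin 8)) := by
  rw [Nat.card_congr (Equiv.ofBijective p1 p1_bij), nat_card_alternatingGroup]
  have := card_GL_field (𝔽 := ZMod 2) 4
  refine this.trans ?_
  simp [Fin.prod_univ_four, ZMod.card, Nat.factorial]

lemma p2_bij : Function.Bijective p2 :=
  (Nat.bijective_iff_injective_and_card p2).2 ⟨p2_inj, card_eq⟩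

end KerdockA8

/-- The alternating group A₈ is isomorphic to the unit group of the matrix ring M₄(F₂)
(whose unit group is GL₄(F₂) = PSL₄(F₂)); in particular A₈ is the unit group of a ring. -/
theorem stmt_13 :
    Nonempty ((alternatingGroup (Fin 8)) ≃* (Matrix (Fin 4) (Fin 4) (ZMod 2))ˣ) :=
  ⟨(MulEquiv.ofBijective KerdockA8.p2 KerdockA8.p2_bij).symm.trans
    (MulEquiv.ofBijective KerdockA8.p1 KerdockA8.p1_bij)⟩
end

section
/- The projective special linear group PSL₂(F₇) is isomorphic to the unit group of a ring; indeed, PSL₂(F₇) ≅ PSL₃(F₂) = GL₃(F₂), which is the unit group of the matrix ring M₃(F₂). -/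
namespace PSL27

abbrev M3 := Matrix (Fin 3) (Fin 3) (ZMod 2)
abbrev SL := Matrix.SpecialLinearGroup (Fin 2) (ZMod 7)

def U : Fin 7 → M3
  | 0 => !![1,0,0;0,1,0;0,0,1]
  | 1 => !![0,0,1;1,0,1;0,1,0]
  | 2 => !![0,1,0;0,1,1;1,0,1]
  | 3 => !![1,0,1;1,1,1;0,1,1]
  | 4 => !![0,1,1;1,1,0;1,1,1]
  | 5 => !![1,1,1;1,0,0;1,1,0]
  | 6 => !![1,1,0;0,0,1;1,0,0]

def W : M3 := !![1,0,0;0,0,1;0,1,0]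

def D : Fin 7 → M3
  | 3 => !![1,0,0;0,0,1;0,1,1]
  | 4 => !![1,0,0;0,0,1;0,1,1]
  | 2 => !![1,0,0;0,1,1;0,1,0]
  | 5 => !![1,0,0;0,1,1;0,1,0]
  | _ => 1

def iv (a : ZMod 7) : ZMod 7 := a * a * a * a * a

def F (a b c d : ZMod 7) : M3 :=
  if c = 0 then D a * U (b * iv a : ZMod 7)
  else U (a * iv c : ZMod 7) * W * D c * U (d * iv c : ZMod 7)

lemma F_one : F 1 0 0 1 = 1 := by decide +kernel

lemma F_w : ∀ a b c d : ZMod 7, a * d - b * c = 1 → F b (-a) d (-c) = F a b c d * F 0 (-1) 1 0 := by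
  decide +kernel

lemma F_u : ∀ a b c d : ZMod 7, a * d - b * c = 1 → F a (a+b) c (c+d) = F a b c d * F 1 1 0 1 := by
  decide +kernel

lemma F_ker : ∀ a b c d : ZMod 7, a * d - b * c = 1 →
    (F a b c d = 1 ↔ (b = 0 ∧ c = 0 ∧ a = d)) := by
  decide +kernel

lemma card_aux : Fintype.card {p : ZMod 7 × ZMod 7 × ZMod 7 × ZMod 7 //
    p.1 * p.2.2.2 - p.2.1 * p.2.2.1 = 1} = 336 := by
  decide +kernel

def f (g : SL) : M3 := F (g.1 0 0) (g.1 0 1) (g.1 1 0) (g.1 1 1)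

lemma det_eq (g : SL) : g.1 0 0 * g.1 1 1 - g.1 0 1 * g.1 1 0 = 1 := by
  rw [← Matrix.det_fin_two]; exact g.2

lemma mul_val (a b : SL) (i j : Fin 2) :
    (a * b).1 i j = a.1 i 0 * b.1 0 j + a.1 i 1 * b.1 1 j := by
  rw [Matrix.SpecialLinearGroup.coe_mul, Matrix.mul_apply, Fin.sum_univ_two]

def w : SL := ⟨!![0,-1;1,0], by decide⟩
def u : SL := ⟨!![1,1;0,1], by decide⟩

def S : Submonoid SL where
  carrier := {h | ∀ g, f (g * h) = f g * f h}
  one_mem' := by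
    intro g
    have : f 1 = 1 := F_one
    rw [this]; simp
  mul_mem' := by
    intro a b ha hb g
    rw [← mul_assoc, hb, ha, hb, mul_assoc]

lemma w_mem : w ∈ S := by
  intro g
  have := F_w _ _ _ _ (det_eq g)
  simp only [f, mul_val]
  simpa [w] using this

lemma u_mem : u ∈ S := by
  intro g
  have := F_u _ _ _ _ (det_eq g)
  simp only [f, mul_val]
  simpa [u] using this

lemma u_pow (n : ℕ) : (u ^ n).1 = !![1, (n : ZMod 7); 0, 1] := by
  induction n with
  | zero => simp [Matrix.one_fin_two]
  | succ n ih =>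
    rw [pow_succ, Matrix.SpecialLinearGroup.coe_mul, ih]
    simp [u, add_comm]

lemma mem_of_ne (g : SL) (hc : g.1 1 0 ≠ 0) : g ∈ S := by
  obtain ⟨p, hp⟩ : ∃ p : ℕ, (p : ZMod 7) = (g.1 0 0 - 1) * (g.1 1 0)⁻¹ :=
    ⟨_, ZMod.natCast_zmod_val _⟩
  obtain ⟨q, hq⟩ : ∃ p : ℕ, (p : ZMod 7) = (g.1 1 1 - 1) * (g.1 1 0)⁻¹ :=
    ⟨_, ZMod.natCast_zmod_val _⟩
  obtain ⟨r, hr⟩ : ∃ p : ℕ, (p : ZMod 7) = - (g.1 1 0) :=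
    ⟨_, ZMod.natCast_zmod_val _⟩
  have hd := det_eq g
  have : Fact (Nat.Prime 7) := ⟨by norm_num⟩
  have : g = u ^ p * (w * u ^ r * (w * w * w)) * u ^ q := by
    apply Subtype.ext
    simp only [Matrix.SpecialLinearGroup.coe_mul, u_pow, hp, hq, hr]
    generalize g.1 = A at *
    rw [Matrix.eta_fin_two A]
    generalize A 0 0 = a at *
    generalize A 0 1 = b at *
    generalize A 1 0 = c at *
    generalize A 1 1 = d at *
    have hb : b = (a * d - 1) * c⁻¹ := by
      field_simp; linear_combination -hd
    subst hb
    ext i j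
    fin_cases i <;> fin_cases j <;> simp [w] <;>
      field_simp <;> ring
  rw [this]
  have h1 := fun n => S.pow_mem u_mem n
  have h2 := w_mem
  exact S.mul_mem (S.mul_mem (h1 _) (S.mul_mem (S.mul_mem h2 (h1 _))
    (S.mul_mem (S.mul_mem h2 h2) h2))) (h1 _)

lemma mem_all (g : SL) : g ∈ S := by
  by_cases hc : g.1 1 0 = 0
  · have h : g = g * w * (w * w * w) := by
      have : w * (w * w * w) = 1 := by decide
      rw [mul_assoc, this, mul_one]
    rw [h]
    refine S.mul_mem (mem_of_ne _ ?_) (S.mul_mem (S.mul_mem w_mem w_mem) w_mem)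
    have hd := det_eq g
    intro h0
    have h1 : g.1 1 1 = 0 := by
      rw [mul_val] at h0
      simpa [w] using h0
    rw [hc, h1] at hd
    simp only [mul_zero, sub_zero] at hd
    exact absurd hd (by decide)
  · exact mem_of_ne g hc

def fh : SL →* M3 where
  toFun := f
  map_one' := F_one
  map_mul' a b := mem_all b a

lemma mem_center (g : SL) : g ∈ Subgroup.center SL ↔ f g = 1 := by
  rw [f, F_ker _ _ _ _ (det_eq g), Matrix.SpecialLinearGroup.mem_center_iff]
  constructor
  · rintro ⟨r, -, h⟩
    simp [← h]
  · rintro ⟨hb, hc, hd⟩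
    have := det_eq g
    refine ⟨g.1 0 0, ?_, ?_⟩
    · rw [hb, ← hd] at this
      simp only [Fintype.card_fin]
      linear_combination this
    · ext i j
      fin_cases i <;> fin_cases j <;> simp [hb, hc, hd]

lemma ker_eq : fh.toHomUnits.ker = Subgroup.center SL := by
  ext g
  rw [MonoidHom.ker_toHomUnits, MonoidHom.mem_ker, mem_center]
  rfl

lemma card_SL : Nat.card SL = 336 := by
  rw [← card_aux, ← Nat.card_eq_fintype_card]
  refine Nat.card_congr
    { toFun := fun g => ⟨(g.1 0 0, g.1 0 1, g.1 1 0, g.1 1 1), det_eq g⟩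
      invFun := fun p => ⟨!![p.1.1, p.1.2.1; p.1.2.2.1, p.1.2.2.2], by
        rw [Matrix.det_fin_two]; exact p.2⟩
      left_inv := fun g => by
        apply Subtype.ext
        exact (Matrix.eta_fin_two g.1).symm
      right_inv := fun p => rfl }

lemma card_center : Nat.card (Subgroup.center SL) ≤ 2 := by
  have h : (Subgroup.center SL : Set SL) ⊆ {1, -1} := by
    intro g hg
    obtain ⟨r, hr, h⟩ := Matrix.SpecialLinearGroup.mem_center_iff.1 hg
    simp only [Fintype.card_fin] at hr
    have key : ∀ r : ZMod 7, r ^ 2 = 1 → r = 1 ∨ r = -1 := by decide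
    rcases key r hr with rfl | rfl
    · left; apply Subtype.ext; rw [← h]; simp
    · right; apply Subtype.ext; rw [← h]; simp only [map_neg, map_one]; rfl
  exact (Set.ncard_le_ncard h (Set.toFinite _)).trans ((Set.ncard_insert_le _ _).trans (by simp))

lemma card_GL : Nat.card M3ˣ = 168 := by
  have : Fact (Nat.Prime 2) := ⟨by norm_num⟩
  have := Matrix.card_GL_field (𝔽 := ZMod 2) 3
  rw [Fin.prod_univ_three] at this
  simpa [ZMod.card] using this

lemma surj : Function.Surjective fh.toHomUnits := by
  rw [← MonoidHom.range_eq_top]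
  have h1 := Subgroup.card_eq_card_quotient_mul_card_subgroup fh.toHomUnits.ker
  rw [Nat.card_congr (QuotientGroup.quotientKerEquivRange fh.toHomUnits).toEquiv, ker_eq,
    card_SL] at h1
  have h2 := card_center
  apply Subgroup.eq_top_of_le_card
  rw [card_GL]
  nlinarith

end PSL27


/-- PSL₂(F₇) is isomorphic to the unit group of the matrix ring M₃(F₂) (whose unit group
is GL₃(F₂) = PSL₃(F₂)); in particular PSL₂(F₇) is the unit group of a ring. -/
theorem stmt_14 :
    Nonempty ((Matrix.SpecialLinearGroup (Fin 2) (ZMod 7) ⧸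
        Subgroup.center (Matrix.SpecialLinearGroup (Fin 2) (ZMod 7))) ≃*
      (Matrix (Fin 3) (Fin 3) (ZMod 2))ˣ) := by
  exact ⟨(QuotientGroup.quotientMulEquivOfEq PSL27.ker_eq.symm).trans
    (QuotientGroup.quotientKerEquivOfSurjective _ PSL27.surj)⟩
end
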